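/- Let G be a finite group and H ⊆ K subgroups of G with H ≠ L(H,Aut(K)). Then Pr(H,Aut(K)) ≥ (1/|S(H,Aut(K))|)·(1 + (|S(H,Aut(K))| − 1)/[H : L(H,Aut(K))]), with equality if and only if orb_K(x) = x·S(H,Aut(K)) for every x ∈ H \ L(H,Aut(K)). -/

import Mathlib

open scoped Pointwise Classical

section AutoCommuting

variable {G : Type*} [Group G]

/-- The set of pairs `(x, α) ∈ H × Aut(K)` whose autocommutator `[x,α] = x⁻¹ α(x)` equals `g`. -/
def autPairs (H K : Subgroup G) (hHK : H ≤ K) (g : G) : Set (↥H × MulAut ↥K) :=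
  {p | ((p.1 : G))⁻¹ * ((p.2 ⟨(p.1 : G), hHK p.1.2⟩ : ↥K) : G) = g}

/-- The generalized autocommuting probability `Pr_g(H, Aut(K))`. -/
noncomputable def prAut (H K : Subgroup G) (hHK : H ≤ K) (g : G) : ℚ :=
  (Nat.card (autPairs H K hHK g) : ℚ) /
    ((Nat.card ↥H : ℚ) * (Nat.card (MulAut ↥K) : ℚ))

/-- The orbit `orb_K(x)` of `x ∈ K` under the natural action of `Aut(K)` on `K`. -/
def orbK (K : Subgroup G) (x : ↥K) : Set ↥K := MulAction.orbit (MulAut ↥K) x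

/-- `C_{Aut(K)}(x)`, the set of automorphisms of `K` fixing `x`. -/
def centAut (K : Subgroup G) (x : ↥K) : Set (MulAut ↥K) := {α | α x = x}

/-- `C_{Aut(K)}(H)`, the set of automorphisms of `K` fixing every element of `H`. -/
def centAutH (H K : Subgroup G) (hHK : H ≤ K) : Set (MulAut ↥K) :=
  {α | ∀ x : ↥H, α ⟨(x : G), hHK x.2⟩ = ⟨(x : G), hHK x.2⟩}

/-- `L(H, Aut(K)) = {x ∈ H : [x,α] = 1 for all α ∈ Aut(K)}`, as a subgroup of `H`. -/
def absCent (H K : Subgroup G) (hHK : H ≤ K) : Subgroup ↥H where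
  carrier := {x | ∀ α : MulAut ↥K, α ⟨(x : G), hHK x.2⟩ = ⟨(x : G), hHK x.2⟩}
  one_mem' := by
    intro α
    have h1 : (⟨((1 : ↥H) : G), hHK (1 : ↥H).2⟩ : ↥K) = 1 := rfl
    rw [h1, map_one]
  mul_mem' := by
    intro a b ha hb α
    have h1 : (⟨((a * b : ↥H) : G), hHK (a * b).2⟩ : ↥K)
        = ⟨(a : G), hHK a.2⟩ * ⟨(b : G), hHK b.2⟩ := rfl
    rw [h1, map_mul, ha α, hb α]
  inv_mem' := by
    intro a ha α
    have h1 : (⟨((a⁻¹ : ↥H) : G), hHK (a⁻¹).2⟩ : ↥K) = (⟨(a : G), hHK a.2⟩ : ↥K)⁻¹ := rfl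
    rw [h1, map_inv, ha α]

theorem mem_absCent {H K : Subgroup G} {hHK : H ≤ K} {x : ↥H} :
    x ∈ absCent H K hHK ↔ ∀ α : MulAut ↥K, α ⟨(x : G), hHK x.2⟩ = ⟨(x : G), hHK x.2⟩ :=
  Iff.rfl

/-- `S(H, Aut(K)) = {[x,α] : x ∈ H, α ∈ Aut(K)}`, as a subset of `K`. -/
def autCommSet (H K : Subgroup G) (hHK : H ≤ K) : Set ↥K :=
  {k | ∃ x : ↥H, ∃ α : MulAut ↥K,
    (⟨(x : G), hHK x.2⟩ : ↥K)⁻¹ * α ⟨(x : G), hHK x.2⟩ = k}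

end AutoCommuting

section AutoCommuting

variable {G : Type*} [Group G] {H K : Subgroup G} (hHK : H ≤ K)

theorem orbK_subset_smul_autCommSet (x : ↥H) :
    orbK K ⟨(x : G), hHK x.2⟩ ⊆ (⟨(x : G), hHK x.2⟩ : ↥K) • autCommSet H K hHK := by
  rintro _ ⟨α, rfl⟩
  exact ⟨_, ⟨x, α, rfl⟩, mul_inv_cancel_left _ _⟩

theorem natCard_orbK_eq_one {x : ↥H} (hx : x ∈ absCent H K hHK) :
    Nat.card (orbK K ⟨(x : G), hHK x.2⟩) = 1 := by
  have : orbK K ⟨(x : G), hHK x.2⟩ = {⟨(x : G), hHK x.2⟩} := by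
    refine Set.Subset.antisymm ?_ (Set.singleton_subset_iff.2 (MulAction.mem_orbit_self _))
    rintro _ ⟨α, rfl⟩
    exact hx α
  rw [this, Nat.card_unique]

theorem natCard_smul_autCommSet (k : ↥K) :
    Nat.card ↥(k • autCommSet H K hHK) = Nat.card (autCommSet H K hHK) :=
  Set.natCard_smul_set k _

variable [Finite G]

theorem natCard_orbK_pos (x : ↥K) : 0 < Nat.card (orbK K x) :=
  have : Nonempty (orbK K x) := ⟨⟨x, MulAction.mem_orbit_self _⟩⟩
  Nat.card_pos

theorem natCard_orbK_le (x : ↥H) :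
    Nat.card (orbK K ⟨(x : G), hHK x.2⟩) ≤ Nat.card (autCommSet H K hHK) := by
  rw [← natCard_smul_autCommSet hHK ⟨(x : G), hHK x.2⟩]
  exact Nat.card_mono (Set.toFinite _) (orbK_subset_smul_autCommSet hHK x)

theorem natCard_orbK_eq_iff (x : ↥H) :
    Nat.card (orbK K ⟨(x : G), hHK x.2⟩) = Nat.card (autCommSet H K hHK) ↔
      orbK K ⟨(x : G), hHK x.2⟩ = (⟨(x : G), hHK x.2⟩ : ↥K) • autCommSet H K hHK := by
  rw [← natCard_smul_autCommSet hHK ⟨(x : G), hHK x.2⟩]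
  refine ⟨fun h => ?_, fun h => by rw [h]⟩
  exact Set.eq_of_subset_of_ncard_le (orbK_subset_smul_autCommSet hHK x)
    (by rw [← Nat.card_coe_set_eq, ← Nat.card_coe_set_eq, h]) (Set.toFinite _)

theorem natCard_autPairs_one [Fintype ↥H] :
    Nat.card (autPairs H K hHK 1) =
      ∑ x : ↥H, Nat.card (MulAction.stabilizer (MulAut ↥K) (⟨(x : G), hHK x.2⟩ : ↥K)) := by
  rw [← Nat.card_sigma]
  refine Nat.card_congr
    { toFun := fun p => ⟨p.1.1, p.1.2, ?_⟩
      invFun := fun q => ⟨(q.1, q.2.1), ?_⟩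
      left_inv := fun _ => rfl
      right_inv := fun _ => rfl }
  · exact Subtype.ext (inv_mul_eq_one.1 p.2).symm
  · exact inv_mul_eq_one.2 (congrArg Subtype.val q.2.2).symm

theorem prAut_one_eq_sum [Fintype ↥H] :
    prAut H K hHK 1 =
      (∑ x : ↥H, (1 / (Nat.card (orbK K ⟨(x : G), hHK x.2⟩) : ℚ))) / Nat.card ↥H := by
  have hA : (Nat.card (MulAut ↥K) : ℚ) ≠ 0 := by
    have : Finite (MulAut ↥K) := Finite.of_injective _ DFunLike.coe_injective
    exact_mod_cast Nat.card_pos.ne'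
  rw [prAut, natCard_autPairs_one, mul_comm, ← div_div, Nat.cast_sum, Finset.sum_div]
  congr 1
  refine Finset.sum_congr rfl fun x _ => ?_
  have ho : (Nat.card (orbK K ⟨(x : G), hHK x.2⟩) : ℚ) ≠ 0 := by
    exact_mod_cast (natCard_orbK_pos _).ne'
  rw [div_eq_div_iff hA ho, one_mul, mul_comm]
  have h := Nat.card_congr
    (MulAction.orbitProdStabilizerEquivGroup (MulAut ↥K) (⟨(x : G), hHK x.2⟩ : ↥K))
  rw [Nat.card_prod] at h
  exact_mod_cast h

theorem natCard_autCommSet_pos : 0 < Nat.card (autCommSet H K hHK) :=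
  (natCard_orbK_pos _).trans_le (natCard_orbK_le hHK 1)

theorem sum_ite_mem_absCent_div [Fintype ↥H] :
    (∑ x : ↥H, if x ∈ absCent H K hHK then (1 : ℚ)
        else 1 / (Nat.card (autCommSet H K hHK) : ℚ)) / Nat.card ↥H =
      (1 / (Nat.card (autCommSet H K hHK) : ℚ)) *
        (1 + ((Nat.card (autCommSet H K hHK) : ℚ) - 1) / ((absCent H K hHK).index : ℚ)) := by
  have hs : (Nat.card (autCommSet H K hHK) : ℚ) ≠ 0 := by
    exact_mod_cast (natCard_autCommSet_pos hHK).ne'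
  have hi : ((absCent H K hHK).index : ℚ) ≠ 0 := by
    exact_mod_cast Subgroup.index_ne_zero_of_finite
  have hL : (Nat.card (absCent H K hHK) : ℚ) ≠ 0 := by exact_mod_cast Nat.card_pos.ne'
  have hH : (Nat.card ↥H : ℚ) = Nat.card (absCent H K hHK) * (absCent H K hHK).index := by
    exact_mod_cast (absCent H K hHK).card_mul_index.symm
  generalize (Nat.card (autCommSet H K hHK) : ℚ) = s at *
  have hsum : (∑ x : ↥H, if x ∈ absCent H K hHK then (1 : ℚ) else 1 / s) =
      Nat.card (absCent H K hHK) * (1 - 1 / s) + Nat.card ↥H * (1 / s) := by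
    have (x : ↥H) : (if x ∈ absCent H K hHK then (1 : ℚ) else 1 / s) =
        (if x ∈ absCent H K hHK then 1 - 1 / s else 0) + 1 / s := by
      split_ifs <;> ring
    simp_rw [this]
    rw [Finset.sum_add_distrib, ← Finset.sum_filter, Finset.sum_const, Finset.sum_const,
      nsmul_eq_mul, nsmul_eq_mul, Finset.card_univ, ← Nat.card_eq_fintype_card,
      ← Fintype.card_subtype, ← Nat.card_eq_fintype_card]
  rw [hsum, hH]
  field_simp
  ring

end AutoCommuting

/-- `Pr(H,Aut(K)) ≥ (1/|S(H,Aut(K))|)(1 + (|S(H,Aut(K))|-1)/[H : L(H,Aut(K))])`, with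
equality iff `orb_K(x) = x S(H,Aut(K))` for every `x ∈ H \ L(H,Aut(K))`. -/
theorem stmt_17 {G : Type*} [Group G] [Fintype G] (H K : Subgroup G) (hHK : H ≤ K)
    (hne : absCent H K hHK ≠ ⊤) :
    prAut H K hHK 1 ≥
        (1 / (Nat.card (autCommSet H K hHK) : ℚ)) *
          (1 + ((Nat.card (autCommSet H K hHK) : ℚ) - 1) /
            ((absCent H K hHK).index : ℚ)) ∧
      (prAut H K hHK 1 =
          (1 / (Nat.card (autCommSet H K hHK) : ℚ)) *
            (1 + ((Nat.card (autCommSet H K hHK) : ℚ) - 1) /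
              ((absCent H K hHK).index : ℚ)) ↔
        ∀ x : ↥H, x ∉ absCent H K hHK →
          orbK K ⟨(x : G), hHK x.2⟩ =
            (⟨(x : G), hHK x.2⟩ : ↥K) • autCommSet H K hHK) := by
  have hpt (x : ↥H) : (if x ∈ absCent H K hHK then (1 : ℚ)
      else 1 / (Nat.card (autCommSet H K hHK) : ℚ)) ≤
      1 / (Nat.card (orbK K ⟨(x : G), hHK x.2⟩) : ℚ) := by
    split_ifs with hx
    · rw [natCard_orbK_eq_one hHK hx, Nat.cast_one, one_div_one]
    · exact one_div_le_one_div_of_le (by exact_mod_cast natCard_orbK_pos _)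
        (by exact_mod_cast natCard_orbK_le hHK x)
  have hH : (0 : ℚ) < Nat.card ↥H := by exact_mod_cast Nat.card_pos
  rw [← sum_ite_mem_absCent_div hHK, prAut_one_eq_sum hHK]
  refine ⟨div_le_div_of_nonneg_right (Finset.sum_le_sum fun x _ => hpt x) hH.le, ?_⟩
  rw [div_left_inj' hH.ne', eq_comm, Finset.sum_eq_sum_iff_of_le fun x _ => hpt x]
  refine forall_congr' fun x => ?_
  by_cases hx : x ∈ absCent H K hHK
  · rw [natCard_orbK_eq_one hHK hx]
    simp [hx]
  · rw [if_neg hx, ← natCard_orbK_eq_iff hHK, one_div, one_div, inv_inj, Nat.cast_inj]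
    simp [hx, eq_comm]
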